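/- Let Γ = (m_{i,j})_{i,j∈I} be a Coxeter matrix and let (W,S) be its Coxeter system. For a non-empty subset J ⊆ I, suppose W_J is finite with longest element r_J. If {α, β} is the bipartite 2-partition of an irreducible finite Coxeter system (W,S) (i.e. m_{i,j} = 2 for i ≠ j within α and within β), then prod_h(r_α, r_β) = r_I where h is the Coxeter number of W, and ℓ(r_I) = Σ_h(ℓ(r_α), ℓ(r_β)). -/

import Mathlib

/-- Alternating product `xyxy⋯` of `n` factors. -/
def altProd {W : Type*} [Monoid W] (x y : W) : ℕ → W
  | 0 => 1
  | n + 1 => x * altProd y x n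

/-- Alternating sum `a + b + a + ⋯` of `n` terms. -/
def altSum (a b : ℕ) : ℕ → ℕ
  | 0 => 0
  | n + 1 => a + altSum b a n

/-- `x` is the longest element of the standard parabolic subgroup generated by `α`. -/
def IsLongestOf {B W : Type*} [Group W] {M : CoxeterMatrix B} (cs : CoxeterSystem M W)
    (α : Set B) (x : W) : Prop :=
  x ∈ Subgroup.closure (cs.simple '' α) ∧
  (∀ u ∈ Subgroup.closure (cs.simple '' α), cs.length u ≤ cs.length x) ∧
  (∀ u ∈ Subgroup.closure (cs.simple '' α), cs.length u = cs.length x → u = x)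


namespace BipCox

open Real

/-- Chebyshev-like sequence. -/
noncomputable def chebP (c : ℝ) : ℕ → ℝ
  | 0 => 0
  | 1 => 1
  | n + 2 => c * chebP c (n + 1) - chebP c n

lemma chebP_sin (θ : ℝ) (n : ℕ) :
    Real.sin θ * chebP (2 * Real.cos θ) n = Real.sin (n * θ) ∧
    Real.sin θ * chebP (2 * Real.cos θ) (n + 1) = Real.sin ((n + 1 : ℕ) * θ) := by
  induction n with
  | zero => simp [chebP]
  | succ n ih =>
    refine ⟨ih.2, ?_⟩
    obtain ⟨h1, h2⟩ := ih
    rw [chebP, mul_sub, h1]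
    have : Real.sin θ * (2 * Real.cos θ * chebP (2 * Real.cos θ) (n + 1))
        = 2 * Real.cos θ * Real.sin ((n + 1 : ℕ) * θ) := by rw [← h2]; ring
    rw [this]
    have e1 : ((n + 1 + 1 : ℕ) : ℝ) * θ = (n + 1 : ℕ) * θ + θ := by push_cast; ring
    have e2 : (n : ℝ) * θ = (n + 1 : ℕ) * θ - θ := by push_cast; ring
    rw [e1, e2, Real.sin_add, Real.sin_sub]; ring

lemma chebP_two (n : ℕ) : chebP 2 n = n ∧ chebP 2 (n + 1) = n + 1 := by
  induction n with
  | zero => simp [chebP]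
  | succ n ih =>
    refine ⟨by rw [ih.2]; push_cast; ring, ?_⟩
    rw [chebP, ih.1, ih.2]; push_cast; ring

lemma chebP_nonneg (m n : ℕ) (hm1 : m ≠ 1) (h : m = 0 ∨ n ≤ m) :
    0 ≤ chebP (2 * Real.cos (π / m)) n := by
  rcases Nat.eq_zero_or_pos m with rfl | hm
  · simp [(chebP_two n).1]
  · have hn : n ≤ m := by omega
    have hm2 : 2 ≤ m := by omega
    have hm0 : (0 : ℝ) < m := by exact_mod_cast hm
    have hs : 0 < Real.sin (π / m) := by
      apply Real.sin_pos_of_pos_of_lt_pi (by positivity)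
      apply div_lt_self Real.pi_pos
      exact_mod_cast hm2
    have := (chebP_sin (π / m) n).1
    have h2 : 0 ≤ Real.sin (n * (π / m)) := by
      apply Real.sin_nonneg_of_nonneg_of_le_pi (by positivity)
      have : (n : ℝ) ≤ m := by exact_mod_cast hn
      calc (n : ℝ) * (π / m) ≤ m * (π / m) := by gcongr
        _ = π := by field_simp
    rw [← this] at h2
    exact nonneg_of_mul_nonneg_right h2 hs

variable {B W : Type*} [Group W] {M : CoxeterMatrix B}

/-- `2 cos(π/m_ij)`. -/
noncomputable def kk (M : CoxeterMatrix B) (i j : B) : ℝ := 2 * Real.cos (π / (M i j : ℕ))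

lemma kk_symm (i j : B) : kk M i j = kk M j i := by rw [kk, kk, M.symmetric]

lemma kk_self (i : B) : kk M i i = -2 := by simp [kk]

lemma kk_two {i j : B} (h : M i j = 2) : kk M i j = 0 := by simp [kk, h]

lemma kk_nonneg {i j : B} (h : i ≠ j) : 0 ≤ kk M i j := by
  have h1 := M.off_diagonal i j h
  have := chebP_nonneg (M i j) 2 h1
  rw [kk]
  rcases Nat.eq_zero_or_pos (M i j) with h0 | hm
  · simp [h0]
  · simpa [chebP] using this (by right; have : 0 < M.M i j := hm; omega)

lemma kk_pos {i j : B} (h : i ≠ j) (h2 : M.M i j ≠ 2) : 0 < kk M i j := by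
  have h1 := M.off_diagonal i j h
  rw [kk]
  rcases Nat.eq_zero_or_pos (M.M i j) with h0 | hm
  · simp [h0]
  · have h3 : (3 : ℝ) ≤ M.M i j := by
      have : 3 ≤ M.M i j := by omega
      exact_mod_cast this
    have : 0 < Real.cos (π / M.M i j) := by
      apply Real.cos_pos_of_mem_Ioo
      have hp := Real.pi_pos
      constructor
      · have : 0 < π / M.M i j := by positivity
        linarith
      · apply div_lt_div_of_pos_left hp (by norm_num); linarith
    linarith

variable [Fintype B] [DecidableEq B]

/-- coroot functional -/
noncomputable def cor (M : CoxeterMatrix B) (i : B) : Module.Dual ℝ (B → ℝ) :=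
  -∑ j, kk M i j • LinearMap.proj j

/-- simple root -/
def rt (i : B) : B → ℝ := Pi.single i 1

lemma cor_rt (i j : B) : cor M i (rt j) = -kk M i j := by
  simp [cor, rt, Pi.single_apply]

lemma cor_self (i : B) : cor M i (rt i) = 2 := by simp [cor_rt, kk_self]

open Polynomial.Chebyshev in
lemma liftable : M.IsLiftable (fun i => Module.reflection (cor_self (M := M) i)) := by
  intro i j
  by_cases hij : i = j
  · subst hij
    simp only [M.diagonal, pow_one]
    ext1 z
    exact Module.involutive_reflection (cor_self i) z
  have hm1 := M.off_diagonal i j hij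
  change _ ^ (M.M i j) = _
  set m := M.M i j with hm
  rcases Nat.eq_zero_or_pos m with h0 | hpos
  · rw [h0, pow_zero]
  have ht : 2 * Real.cos (2 * (π / m)) = cor M i (rt j) * cor M j (rt i) - 2 := by
    rw [cor_rt, cor_rt, kk_symm j i, kk, Real.cos_two_mul]; ring
  ext1 z
  have key := Module.reflection_mul_reflection_pow_apply (cor_self (M := M) i)
    (cor_self (M := M) j) m z _ ht
  refine key.trans ?_
  change _ = z
  have hm0 : (0 : ℝ) < m := by exact_mod_cast hpos
  by_cases hm2 : m = 2
  · have hk : kk M i j = 0 := kk_two hm2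
    have hk' : kk M j i = 0 := by rw [kk_symm, hk]
    rw [hm2]
    simp only [cor_rt, hk, hk']
    norm_num
    have : (2 * (π / 2)) = π := by ring
    simp [this]
    module
  have hs : Real.sin (2 * (π / m)) ≠ 0 := by
    apply ne_of_gt
    apply Real.sin_pos_of_pos_of_lt_pi (by positivity)
    have : (3 : ℝ) ≤ m := by
      have : 3 ≤ m := by omega
      exact_mod_cast this
    rw [← mul_div_assoc, div_lt_iff₀ hm0]
    nlinarith [Real.pi_pos]
  have hS := fun n : ℤ => S_two_mul_real_cos (2 * (π / m)) n
  rcases Nat.even_or_odd' m with ⟨k, hk | hk⟩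
  · have e1 : ((m : ℤ) - 2) / 2 = k - 1 := by omega
    have e2 : ((m : ℤ) - 1) / 2 = k - 1 := by omega
    have hz : (S ℝ ((k : ℤ) - 1)).eval (2 * Real.cos (2 * (π / m))) = 0 := by
      have := hS ((k : ℤ) - 1)
      have e : (((k : ℤ) - 1 : ℤ) + 1 : ℝ) * (2 * (π / m)) = π := by
        have : (m : ℝ) = 2 * k := by exact_mod_cast hk
        push_cast
        rw [sub_add_cancel]
        field_simp
        linarith
      rw [e, Real.sin_pi] at this
      exact (mul_eq_zero.mp this).resolve_right hs
    rw [e1, e2, hz]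
    simp
  · have e1 : ((m : ℤ) - 2) / 2 = k - 1 := by omega
    have e2 : ((m : ℤ) - 1) / 2 = k := by omega
    have e3 : ((m : ℤ) - 3) / 2 = k - 1 := by omega
    have e4 : (m : ℤ) / 2 = k := by omega
    have hz : (S ℝ (k : ℤ)).eval (2 * Real.cos (2 * (π / m))) +
       (S ℝ ((k : ℤ) - 1)).eval (2 * Real.cos (2 * (π / m))) = 0 := by
      have h1 := hS ((k : ℤ) - 1)
      have h2 := hS k
      have hmk : (m : ℝ) = 2 * k + 1 := by exact_mod_cast hk
      have hmt : (m : ℝ) * (π / m) = π := by field_simp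
      have e : (((k : ℤ) - 1 : ℤ) + 1 : ℝ) * (2 * (π / m)) = π - π / m := by
        push_cast
        rw [sub_add_cancel]
        linear_combination hmt - hmk * (π / m)
      have e' : (((k : ℤ) : ℤ) + 1 : ℝ) * (2 * (π / m)) = π / m + π := by
        push_cast
        linear_combination hmt - hmk * (π / m)
      rw [e, Real.sin_pi_sub] at h1
      rw [e', Real.sin_add_pi] at h2
      have : ((S ℝ (k : ℤ)).eval (2 * Real.cos (2 * (π / m))) +
       (S ℝ ((k : ℤ) - 1)).eval (2 * Real.cos (2 * (π / m)))) * Real.sin (2 * (π / m)) = 0 := by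
        rw [add_mul, h1, h2]; ring
      exact (mul_eq_zero.mp this).resolve_right hs
    rw [e1, e2, e3, e4, hz]
    simp

/-- geometric representation -/
noncomputable def rep (cs : CoxeterSystem M W) : W →* ((B → ℝ) ≃ₗ[ℝ] (B → ℝ)) :=
  cs.lift ⟨_, liftable⟩

lemma rep_simple (cs : CoxeterSystem M W) (i : B) (z : B → ℝ) :
    rep cs (cs.simple i) z = z - cor M i z • rt i := by
  rw [rep, cs.lift_apply_simple liftable, Module.reflection_apply]

lemma rep_simple_rt (cs : CoxeterSystem M W) (i j : B) :
    rep cs (cs.simple i) (rt j) = rt j + kk M i j • rt i := by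
  rw [rep_simple, cor_rt]; module

lemma rep_simple_self (cs : CoxeterSystem M W) (i : B) :
    rep cs (cs.simple i) (rt i) = - rt i := by
  rw [rep_simple_rt, kk_self]; module

lemma rep_alt (cs : CoxeterSystem M W) (s t : B) (k : ℕ) :
    rep cs (cs.wordProd (CoxeterSystem.alternatingWord s t k)) (rt s) =
      if Even k then chebP (kk M s t) (k + 1) • rt s + chebP (kk M s t) k • rt t
      else chebP (kk M s t) k • rt s + chebP (kk M s t) (k + 1) • rt t := by
  induction k with
  | zero => simp [CoxeterSystem.alternatingWord, chebP]
  | succ k ih =>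
    rw [CoxeterSystem.alternatingWord_succ', cs.wordProd_cons, map_mul, LinearEquiv.mul_apply, ih]
    by_cases hk : Even k
    · have : ¬ Even (k + 1) := by simpa [Nat.even_add_one] using hk
      simp only [hk, this, if_true, if_false, map_add, map_smul, rep_simple_rt, kk_self,
        kk_symm t s, chebP]
      module
    · have : Even (k + 1) := by simpa [Nat.even_add_one] using hk
      simp only [hk, this, if_true, if_false, map_add, map_smul, rep_simple_rt, kk_self, chebP]
      module

/-- The alternating word read letter by letter: next letter to prepend. -/
lemma rep_nonneg_of_not_descent (cs : CoxeterSystem M W) : ∀ (n : ℕ) (w : W), cs.length w = n →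
    ∀ s, ¬ cs.IsRightDescent w s → 0 ≤ rep cs w (rt s) := by
  intro n
  induction n using Nat.strong_induction_on with
  | _ n ih =>
  intro w hw s hs
  by_cases hw1 : w = 1
  · subst hw1
    simp [rt]
  obtain ⟨t, ht⟩ := cs.exists_rightDescent_of_ne_one hw1
  have hst : s ≠ t := fun h => hs (h ▸ ht)
  classical
  -- maximal k
  let P : ℕ → Prop := fun k => ∃ v : W, w = v * cs.wordProd (CoxeterSystem.alternatingWord s t k) ∧
    cs.length v + k = cs.length w
  have hP1 : P 1 := by
    refine ⟨w * cs.simple t, ?_, ?_⟩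
    · simp [CoxeterSystem.alternatingWord]
    · exact cs.isRightDescent_iff.mp ht
  have hPb : ∀ k, P k → k ≤ cs.length w := by
    rintro k ⟨v, -, h⟩; omega
  have hk1 : P (Nat.findGreatest P (cs.length w)) :=
    Nat.findGreatest_spec (P := P) (hPb 1 hP1) hP1
  have hkge : 1 ≤ Nat.findGreatest P (cs.length w) := Nat.le_findGreatest (hPb 1 hP1) hP1
  have hkmax : ¬ P (Nat.findGreatest P (cs.length w) + 1) := by
    intro h
    have := Nat.le_findGreatest (hPb _ h) h
    omega
  generalize Nat.findGreatest P (cs.length w) = k at hk1 hkge hkmax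
  obtain ⟨v, hv, hlen⟩ := hk1
  -- the two letters
  have hnext : ¬ cs.IsRightDescent v (if Even k then t else s) := by
    intro hd
    apply hkmax
    refine ⟨v * cs.simple (if Even k then t else s), ?_, ?_⟩
    · rw [CoxeterSystem.alternatingWord_succ', cs.wordProd_cons, ← mul_assoc,
        cs.simple_mul_simple_cancel_right]
      exact hv
    · have := cs.isRightDescent_iff.mp hd
      omega
  have hprev : ¬ cs.IsRightDescent v (if Even k then s else t) := by
    intro hd
    obtain ⟨k', rfl⟩ : ∃ k', k = k' + 1 := ⟨k - 1, by omega⟩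
    have hh : (if Even (k' + 1) then s else t) = (if Even k' then t else s) := by
      by_cases hk : Even k' <;> simp [hk, Nat.even_add_one]
    rw [hh] at hd
    rw [CoxeterSystem.alternatingWord_succ', cs.wordProd_cons, ← mul_assoc] at hv
    have h1 := cs.length_mul_le (v * cs.simple (if Even k' then t else s))
      (cs.wordProd (CoxeterSystem.alternatingWord s t k'))
    rw [← hv] at h1
    have h2 := cs.length_wordProd_le (CoxeterSystem.alternatingWord s t k')
    rw [CoxeterSystem.length_alternatingWord] at h2
    have := cs.isRightDescent_iff.mp hd
    omega
  have hvs : ¬ cs.IsRightDescent v s := by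
    by_cases hk : Even k
    · simpa [hk] using hprev
    · simpa [hk] using hnext
  have hvt : ¬ cs.IsRightDescent v t := by
    by_cases hk : Even k
    · simpa [hk] using hnext
    · simpa [hk] using hprev
  have h1 := ih (cs.length v) (by omega) v rfl s hvs
  have h2 := ih (cs.length v) (by omega) v rfl t hvt
  have hkm : M.M s t = 0 ∨ k + 1 ≤ M.M s t := by
    by_contra hcon
    push Not at hcon
    obtain ⟨h0, hk⟩ := hcon
    have hk' : M.M s t ≤ k := by omega
    -- split off
    have hsplit : ∀ (d m : ℕ), ∃ l : List B, l.length = d ∧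
        cs.wordProd (CoxeterSystem.alternatingWord s t (d + m)) =
          cs.wordProd l * cs.wordProd (CoxeterSystem.alternatingWord s t m) := by
      intro d m
      induction d with
      | zero => exact ⟨[], rfl, by simp⟩
      | succ d ihd =>
        obtain ⟨l, hl, he⟩ := ihd
        refine ⟨(if Even (d + m) then t else s) :: l, by simp [hl], ?_⟩
        rw [show d + 1 + m = (d + m) + 1 by ring, CoxeterSystem.alternatingWord_succ',
          cs.wordProd_cons, he, cs.wordProd_cons, mul_assoc]
    obtain ⟨l, hl, he⟩ := hsplit (k - M.M s t) (M.M s t)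
    rw [Nat.sub_add_cancel hk'] at he
    have hbr := cs.wordProd_braidWord_eq s t
    change cs.wordProd (CoxeterSystem.alternatingWord s t (M.M s t)) =
      cs.wordProd (CoxeterSystem.alternatingWord t s (M.M t s)) at hbr
    have hsym : M.M t s = M.M s t := M.symmetric t s
    obtain ⟨m', hm'⟩ : ∃ m', M.M s t = m' + 1 := ⟨M.M s t - 1, by omega⟩
    rw [hbr, hsym, hm', CoxeterSystem.alternatingWord_succ, cs.wordProd_concat] at he
    apply hs
    have : w * cs.simple s = v * (cs.wordProd l *
        cs.wordProd (CoxeterSystem.alternatingWord s t m')) := by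
      rw [hv, he]
      simp only [← mul_assoc]
      rw [cs.simple_mul_simple_cancel_right]
    rw [CoxeterSystem.IsRightDescent, this]
    have a1 := cs.length_mul_le v (cs.wordProd l *
        cs.wordProd (CoxeterSystem.alternatingWord s t m'))
    have a2 := cs.length_mul_le (cs.wordProd l)
      (cs.wordProd (CoxeterSystem.alternatingWord s t m'))
    have a3 := cs.length_wordProd_le l
    have a4 := cs.length_wordProd_le (CoxeterSystem.alternatingWord s t m')
    rw [CoxeterSystem.length_alternatingWord] at a4
    omega
  have hm1 := M.off_diagonal s t hst
  have p1 : 0 ≤ chebP (kk M s t) k := chebP_nonneg (M.M s t) k hm1 (by omega)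
  have p2 : 0 ≤ chebP (kk M s t) (k + 1) := chebP_nonneg (M.M s t) (k + 1) hm1 (by omega)
  rw [hv, map_mul, LinearEquiv.mul_apply, rep_alt]
  split_ifs
  · rw [map_add, map_smul, map_smul]
    exact add_nonneg (smul_nonneg p2 h1) (smul_nonneg p1 h2)
  · rw [map_add, map_smul, map_smul]
    exact add_nonneg (smul_nonneg p1 h1) (smul_nonneg p2 h2)

lemma rep_nonpos_of_descent (cs : CoxeterSystem M W) (w : W) (s : B)
    (h : cs.IsRightDescent w s) : rep cs w (rt s) ≤ 0 := by
  have h1 := cs.isRightDescent_iff_not_isRightDescent_mul.mp h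
  have := rep_nonneg_of_not_descent cs _ (w * cs.simple s) rfl s h1
  rw [map_mul, LinearEquiv.mul_apply, rep_simple_self, map_neg] at this
  exact neg_nonneg.mp this

lemma rep_rt_ne (cs : CoxeterSystem M W) (w : W) (s : B) : rep cs w (rt s) ≠ 0 := by
  intro h
  have h2 : (rt s : B → ℝ) = 0 := by simpa using h
  have := congrFun h2 s
  simp [rt] at this

lemma not_descent_iff (cs : CoxeterSystem M W) (w : W) (s : B) :
    ¬ cs.IsRightDescent w s ↔ 0 ≤ rep cs w (rt s) := by
  refine ⟨rep_nonneg_of_not_descent cs _ w rfl s, fun h hd => ?_⟩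
  exact rep_rt_ne cs w s (le_antisymm (rep_nonpos_of_descent cs w s hd) h)

lemma descent_iff (cs : CoxeterSystem M W) (w : W) (s : B) :
    cs.IsRightDescent w s ↔ rep cs w (rt s) ≤ 0 := by
  refine ⟨rep_nonpos_of_descent cs w s, fun h => ?_⟩
  by_contra hd
  exact rep_rt_ne cs w s (le_antisymm h (rep_nonneg_of_not_descent cs _ w rfl s hd))

/-- Perron Frobenius eigenvector. -/
lemma perron [Nonempty B] (hirr : ∀ J K : Set B, J ∪ K = Set.univ → Disjoint J K → J.Nonempty →
      K.Nonempty → ∃ j ∈ J, ∃ k ∈ K, M.M j k ≠ 2) :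
    ∃ (v : B → ℝ) (μ : ℝ), (∀ i, 0 < v i) ∧ ∀ i, ∑ j, kk M i j * v j = (μ - 2) * v i := by
  let C : Matrix B B ℝ := fun i j => kk M i j + if i = j then 2 else 0
  have hC0 : ∀ i j, 0 ≤ C i j := by
    intro i j
    by_cases h : i = j
    · subst h; simp [C, kk_self]
    · simpa [C, h] using kk_nonneg h
  have hCs : IsSelfAdjoint C := by
    change C.conjTranspose = C
    ext i j
    rw [Matrix.conjTranspose_apply]
    by_cases h : i = j
    · subst h; simp
    · simp [C, kk_symm j i, h, Ne.symm h]
  let T := Matrix.toEuclideanCLM (n := B) (𝕜 := ℝ) C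
  have hT : IsSelfAdjoint T := hCs.map _
  have hTa : ∀ (x : EuclideanSpace ℝ B) i, T x i = ∑ j, C i j * x j := by
    intro x i
    rfl
  have hform : ∀ x : EuclideanSpace ℝ B, T.reApplyInnerSelf x = ∑ i, ∑ j, C i j * x j * x i := by
    intro x
    rw [ContinuousLinearMap.reApplyInnerSelf_apply, PiLp.inner_apply]
    simp only [hTa, RCLike.re_to_real]
    refine Finset.sum_congr rfl fun i _ => ?_
    simp [Finset.mul_sum]
    refine Finset.sum_congr rfl fun j _ => ?_
    ring
  obtain ⟨x, hx, hmax⟩ := (isCompact_sphere (0 : EuclideanSpace ℝ B) 1).exists_isMaxOn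
    (NormedSpace.sphere_nonempty.mpr zero_le_one) T.reApplyInnerSelf_continuous.continuousOn
  have hx1 : ‖x‖ = 1 := by simpa using hx
  let y : EuclideanSpace ℝ B := WithLp.toLp 2 (fun i => |x i|)
  have hyi : ∀ i, y i = |x i| := fun i => rfl
  have hy1 : ‖y‖ = 1 := by
    rw [← hx1, EuclideanSpace.norm_eq, EuclideanSpace.norm_eq]
    simp [hyi]
  have hy0 : y ≠ 0 := by
    intro h; rw [h] at hy1; simp at hy1
  have hymax : IsMaxOn T.reApplyInnerSelf (Metric.sphere 0 ‖y‖) y := by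
    rw [hy1]
    intro z hz
    have h1 : T.reApplyInnerSelf z ≤ T.reApplyInnerSelf x := hmax hz
    change T.reApplyInnerSelf z ≤ T.reApplyInnerSelf y
    refine h1.trans ?_
    change T.reApplyInnerSelf x ≤ T.reApplyInnerSelf y
    rw [hform, hform]
    refine Finset.sum_le_sum fun i _ => Finset.sum_le_sum fun j _ => ?_
    rw [hyi, hyi, mul_assoc, mul_assoc, ← abs_mul]
    exact mul_le_mul_of_nonneg_left (le_abs_self _) (hC0 i j)
  have hev := hT.eq_smul_self_of_isLocalExtrOn_real (Or.inr hymax.localize)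
  set μ := T.rayleighQuotient y
  have hev' : ∀ i, ∑ j, C i j * y j = μ * y i := by
    intro i
    rw [← hTa, hev]; simp
  refine ⟨fun i => y i, μ, ?_, ?_⟩
  · by_contra hcon
    push Not at hcon
    obtain ⟨i0, hi0⟩ := hcon
    have hynn : ∀ i, 0 ≤ y i := fun i => by rw [hyi]; exact abs_nonneg _
    obtain ⟨i1, hi1⟩ : ∃ i, y i ≠ 0 := by
      by_contra hh
      push Not at hh
      exact hy0 (by ext i; simp [hh i])
    obtain ⟨j, hj, k, hk, hjk⟩ := hirr {i | y i = 0} {i | y i ≠ 0} (by ext i; simp [em])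
      (by rw [Set.disjoint_left]; intro a ha hb; exact hb ha)
      ⟨i0, le_antisymm hi0 (hynn i0)⟩ ⟨i1, hi1⟩
    have hne : j ≠ k := by rintro rfl; exact hk hj
    have h0 := hev' j
    rw [show y j = 0 from hj, mul_zero,
      Finset.sum_eq_zero_iff_of_nonneg (fun i _ => mul_nonneg (hC0 j i) (hynn i))] at h0
    have := h0 k (Finset.mem_univ _)
    rcases mul_eq_zero.mp this with h | h
    · have hp := kk_pos hne hjk
      simp [C, hne] at h
      linarith
    · exact hk h
  · intro i
    have := hev' i
    simp only [C, add_mul, Finset.sum_add_distrib, ite_mul, zero_mul, Finset.sum_ite_eq,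
      Finset.mem_univ, if_true] at this
    linarith

/-- `α` is a set of pairwise commuting generators. -/
def Comm2 (M : CoxeterMatrix B) (α : Set B) : Prop := ∀ i ∈ α, ∀ j ∈ α, i ≠ j → M.M i j = 2

lemma rep_fix {cs : CoxeterSystem M W} {α : Set B} (hα : Comm2 M α) {i j : B} (hi : i ∈ α)
    (hj : j ∈ α) (hij : i ≠ j) : rep cs (cs.simple i) (rt j) = rt j := by
  rw [rep_simple_rt, kk_two (hα i hi j hj hij)]; simp

lemma length_mul_list (cs : CoxeterSystem M W) {α : Set B} (hα : Comm2 M α) (l : List B) :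
    ∀ w : W, l.Nodup → (∀ i ∈ l, i ∈ α) → (∀ i ∈ l, 0 ≤ rep cs w (rt i)) →
    cs.length (w * cs.wordProd l) = cs.length w + l.length := by
  induction l with
  | nil => intro w _ _ _; simp
  | cons i l ih =>
    intro w hn hl hw
    rw [List.nodup_cons] at hn
    rw [cs.wordProd_cons, ← mul_assoc, ih (w * cs.simple i) hn.2
      (fun j hj => hl j (List.mem_cons_of_mem _ hj))]
    · have := cs.not_isRightDescent_iff.mp ((not_descent_iff cs w i).mpr (hw i List.mem_cons_self))
      rw [this, List.length_cons]; ring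
    · intro j hj
      rw [map_mul, LinearEquiv.mul_apply, rep_fix hα (hl i List.mem_cons_self)
        (hl j (List.mem_cons_of_mem _ hj)) (by rintro rfl; exact hn.1 hj)]
      exact hw j (List.mem_cons_of_mem _ hj)

lemma rep_list_fix (cs : CoxeterSystem M W) {α : Set B} (hα : Comm2 M α) (l : List B) (j : B)
    (hj : j ∈ α) (hl : ∀ i ∈ l, i ∈ α) (hjl : j ∉ l) :
    rep cs (cs.wordProd l) (rt j) = rt j := by
  induction l with
  | nil => simp
  | cons i l ih =>
    rw [List.mem_cons, not_or] at hjl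
    rw [cs.wordProd_cons, map_mul, LinearEquiv.mul_apply,
      ih (fun j hj => hl j (List.mem_cons_of_mem _ hj)) hjl.2,
      rep_fix hα (hl i List.mem_cons_self) hj (Ne.symm hjl.1)]

lemma rep_list_neg (cs : CoxeterSystem M W) {α : Set B} (hα : Comm2 M α) (l : List B) (j : B)
    (hl : ∀ i ∈ l, i ∈ α) (hn : l.Nodup) (hjl : j ∈ l) :
    rep cs (cs.wordProd l) (rt j) = - rt j := by
  induction l with
  | nil => simp at hjl
  | cons i l ih =>
    rw [List.nodup_cons] at hn
    have hl' : ∀ i ∈ l, i ∈ α := fun j hj => hl j (List.mem_cons_of_mem _ hj)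
    rw [cs.wordProd_cons, map_mul, LinearEquiv.mul_apply]
    by_cases h : j = i
    · subst h
      rw [rep_list_fix cs hα l j (hl j List.mem_cons_self) hl' hn.1, rep_simple_self]
    · have hjl' : j ∈ l := by simpa [h] using hjl
      rw [ih hl' hn.2 hjl', map_neg, rep_fix hα (hl i List.mem_cons_self) (hl' j hjl') (Ne.symm h)]

lemma rep_list_other (cs : CoxeterSystem M W) {α : Set B} (hα : Comm2 M α) (l : List B) (j : B)
    (hl : ∀ i ∈ l, i ∈ α) (hn : l.Nodup) (hjl : j ∉ α) :
    rep cs (cs.wordProd l) (rt j) = rt j + ∑ i ∈ l.toFinset, kk M i j • rt i := by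
  induction l with
  | nil => simp
  | cons i l ih =>
    rw [List.nodup_cons] at hn
    have hl' : ∀ i ∈ l, i ∈ α := fun j hj => hl j (List.mem_cons_of_mem _ hj)
    rw [cs.wordProd_cons, map_mul, LinearEquiv.mul_apply, ih hl' hn.2, List.toFinset_cons,
      Finset.sum_insert (by simpa using hn.1), map_add, map_sum, rep_simple_rt, add_assoc]
    congr 2
    refine Finset.sum_congr rfl fun k hk => ?_
    have hk' : k ∈ l := by simpa using hk
    rw [map_smul, rep_fix hα (hl i List.mem_cons_self) (hl' k hk')
      (by rintro rfl; exact hn.1 hk')]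

lemma simple_comm (cs : CoxeterSystem M W) {i j : B} (h : M.M i j = 2) :
    cs.simple i * cs.simple j = cs.simple j * cs.simple i := by
  have h1 := cs.simple_mul_simple_pow i j
  rw [show M i j = 2 from h, pow_two] at h1
  have h2 := eq_inv_of_mul_eq_one_left h1
  rw [h2, mul_inv_rev, cs.inv_simple, cs.inv_simple]

lemma closure_list (cs : CoxeterSystem M W) {α : Set B} (hα : Comm2 M α) (u : W)
    (hu : u ∈ Subgroup.closure (cs.simple '' α)) :
    ∃ l : List B, l.Nodup ∧ (∀ i ∈ l, i ∈ α) ∧ u = cs.wordProd l := by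
  have step : ∀ i ∈ α, ∀ u : W, (∃ l : List B, l.Nodup ∧ (∀ i ∈ l, i ∈ α) ∧ u = cs.wordProd l) →
      ∃ l : List B, l.Nodup ∧ (∀ i ∈ l, i ∈ α) ∧ cs.simple i * u = cs.wordProd l := by
    rintro i hi u ⟨l, hn, hl, rfl⟩
    by_cases hil : i ∈ l
    · have hp := List.perm_cons_erase hil
      refine ⟨l.erase i, hn.erase i, fun j hj => hl j (List.mem_of_mem_erase hj), ?_⟩
      have : cs.wordProd l = cs.wordProd (i :: l.erase i) := by
        rw [CoxeterSystem.wordProd, CoxeterSystem.wordProd]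
        refine List.Perm.prod_eq' (hp.map _) ?_
        rw [List.pairwise_map]
        refine hn.imp_of_mem ?_
        intro a b ha hb hab
        exact simple_comm cs (hα a (hl a ha) b (hl b hb) hab)
      rw [this, cs.wordProd_cons, cs.simple_mul_simple_cancel_left]
    · exact ⟨i :: l, List.nodup_cons.mpr ⟨hil, hn⟩, by simpa using ⟨hi, hl⟩,
        (cs.wordProd_cons i l).symm⟩
  refine Subgroup.closure_induction_left (p := fun u _ => ∃ l : List B, l.Nodup ∧
    (∀ i ∈ l, i ∈ α) ∧ u = cs.wordProd l) ⟨[], by simp⟩ ?_ ?_ hu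
  · rintro _ ⟨i, hi, rfl⟩ y _ hy
    exact step i hi y hy
  · rintro _ ⟨i, hi, rfl⟩ y _ hy
    rw [cs.inv_simple]
    exact step i hi y hy

lemma wordProd_mem (cs : CoxeterSystem M W) {α : Set B} (l : List B) (hl : ∀ i ∈ l, i ∈ α) :
    cs.wordProd l ∈ Subgroup.closure (cs.simple '' α) := by
  induction l with
  | nil => simp
  | cons i l ih =>
    rw [cs.wordProd_cons]
    exact mul_mem (Subgroup.subset_closure ⟨i, hl i List.mem_cons_self, rfl⟩)
      (ih fun j hj => hl j (List.mem_cons_of_mem _ hj))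

lemma longest_eq (cs : CoxeterSystem M W) {α : Set B} (hα : Comm2 M α) (r : W)
    (hr : IsLongestOf cs α r) (l : List B) (hn : l.Nodup) (hl : ∀ i, i ∈ l ↔ i ∈ α) :
    r = cs.wordProd l := by
  obtain ⟨h1, h2, h3⟩ := hr
  have hl' : ∀ i ∈ l, i ∈ α := fun i hi => (hl i).mp hi
  have hm := wordProd_mem cs l hl'
  have hlen := length_mul_list cs hα l 1 hn hl' (fun i _ => by simp [rt])
  rw [one_mul, cs.length_one, zero_add] at hlen
  obtain ⟨l', hn', hl2, he⟩ := closure_list cs hα r h1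
  have h4 : l'.length ≤ l.length :=
    (hn'.subperm (fun i hi => (hl i).mpr (hl2 i hi))).length_le
  have h5 := cs.length_wordProd_le l'
  rw [← he] at h5
  have h6 := h2 _ hm
  exact (h3 _ hm (by omega)).symm

lemma eq_one_of_nonneg (cs : CoxeterSystem M W) (w : W) (h : ∀ i, 0 ≤ rep cs w (rt i)) :
    w = 1 := by
  by_contra hw
  obtain ⟨i, hi⟩ := cs.exists_rightDescent_of_ne_one hw
  exact (not_descent_iff cs w i).mpr (h i) hi

lemma eq_longest (cs : CoxeterSystem M W) (rI : W) (hr : IsLongestOf cs Set.univ rI) (w : W)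
    (hw : ∀ i, rep cs w (rt i) ≤ 0) : w = rI := by
  have hall : ∀ u : W, u ∈ Subgroup.closure (cs.simple '' Set.univ) := by
    intro u
    rw [Set.image_univ, cs.subgroup_closure_range_simple]; trivial
  have hrI : ∀ i, rep cs rI (rt i) ≤ 0 := by
    intro i
    rw [← descent_iff]
    exact lt_of_le_of_ne (hr.2.1 _ (hall _)) (cs.length_mul_simple_ne rI i)
  have key : ∀ u : W, (∀ i, rep cs u (rt i) ≤ 0) → u * rI = 1 := by
    intro u hu
    apply eq_one_of_nonneg cs
    intro i
    rw [map_mul, LinearEquiv.mul_apply]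
    have hdec : rep cs rI (rt i) = ∑ j, (rep cs rI (rt i) j) • (rt j : B → ℝ) := by
      ext k; simp [rt, Pi.single_apply]
    rw [hdec, map_sum]
    refine Finset.sum_nonneg fun j _ => ?_
    rw [map_smul]
    exact smul_nonneg_of_nonpos_of_nonpos (hrI i j) (hu j)
  have h1 := eq_inv_of_mul_eq_one_left (key w hw)
  have h2 := eq_inv_of_mul_eq_one_left (key rI hrI)
  rw [h1, ← h2]

/-- `w` has values `a v` on `α` and `b v` on `β`. -/
def St (cs : CoxeterSystem M W) (v : B → ℝ) (α β : Set B) (w : W) (a b : ℝ) : Prop :=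
  (∀ i ∈ α, ∑ k, v k * rep cs w (rt i) k = a * v i) ∧
  (∀ i ∈ β, ∑ k, v k * rep cs w (rt i) k = b * v i)

lemma St.symm {cs : CoxeterSystem M W} {v : B → ℝ} {α β : Set B} {w : W} {a b : ℝ}
    (h : St cs v α β w a b) : St cs v β α w b a := ⟨h.2, h.1⟩

lemma St.one (cs : CoxeterSystem M W) (v : B → ℝ) (α β : Set B) : St cs v α β 1 1 1 := by
  constructor <;> intro i _ <;> simp [rt, Pi.single_apply]

lemma St.step {cs : CoxeterSystem M W} {v : B → ℝ} {α β : Set B} {w : W} {a b μ : ℝ}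
    (hα : Comm2 M α) (hβ : Comm2 M β) (hunion : α ∪ β = Set.univ) (hdisj : Disjoint α β)
    (hv : ∀ i, ∑ j, kk M i j * v j = (μ - 2) * v i)
    (l : List B) (hn : l.Nodup) (hl : ∀ i, i ∈ l ↔ i ∈ α)
    (h : St cs v α β w a b) : St cs v β α (w * cs.wordProd l) (b + μ * a) (-a) := by
  have hl' : ∀ i ∈ l, i ∈ α := fun i hi => (hl i).mp hi
  refine ⟨fun j hj => ?_, fun i hi => ?_⟩
  · have hjα : j ∉ α := fun hh => Set.disjoint_left.mp hdisj hh hj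
    rw [map_mul, LinearEquiv.mul_apply, rep_list_other cs hα l j hl' hn hjα, map_add, map_sum]
    simp only [map_smul, Pi.add_apply, Finset.sum_apply, Pi.smul_apply, smul_eq_mul, mul_add,
      Finset.sum_add_distrib, Finset.mul_sum]
    rw [h.2 j hj, Finset.sum_comm]
    have e1 : ∀ i ∈ l.toFinset, ∑ k, v k * (kk M i j * rep cs w (rt i) k) = a * (kk M j i * v i) := by
      intro i hi
      have hi' : i ∈ α := hl' i (by simpa using hi)
      have := h.1 i hi'
      calc _ = kk M i j * ∑ k, v k * rep cs w (rt i) k := by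
            rw [Finset.mul_sum]; exact Finset.sum_congr rfl fun k _ => by ring
        _ = _ := by rw [this, kk_symm i j]; ring
    rw [Finset.sum_congr rfl e1, ← Finset.mul_sum]
    have e2 : ∑ i ∈ l.toFinset, kk M j i * v i = μ * v j := by
      have h0 := hv j
      have : ∑ i, kk M j i * v i = ∑ i ∈ l.toFinset, kk M j i * v i + kk M j j * v j := by
        rw [← Finset.sum_add_sum_compl l.toFinset]
        congr 1
        refine Finset.sum_eq_single_of_mem j ?_ ?_
        · simp [hl, hjα]
        · intro k hk hkj
          have hkα : k ∉ α := by simpa [hl] using hk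
          have hkβ : k ∈ β := by
            have : k ∈ α ∪ β := by rw [hunion]; trivial
            exact this.resolve_left hkα
          rw [kk_two (hβ j hj k hkβ (Ne.symm hkj)), zero_mul]
      rw [this, kk_self] at h0
      linarith
    rw [e2]; ring
  · rw [map_mul, LinearEquiv.mul_apply, rep_list_neg cs hα l i hl' hn ((hl i).mpr hi), map_neg]
    simp only [Pi.neg_apply, mul_neg, Finset.sum_neg_distrib]
    rw [h.1 i hi]; ring

lemma sum_pos_of_nonneg (cs : CoxeterSystem M W) (v : B → ℝ) (hv : ∀ i, 0 < v i) (w : W) (i : B)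
    (a : ℝ) (h : ∑ k, v k * rep cs w (rt i) k = a * v i) :
    (0 < a → 0 ≤ rep cs w (rt i)) ∧ (a ≤ 0 → rep cs w (rt i) ≤ 0) := by
  by_cases hd : cs.IsRightDescent w i
  · have hh := (descent_iff cs w i).mp hd
    refine ⟨fun ha => ?_, fun _ => hh⟩
    have h1 : 0 < a * v i := mul_pos ha (hv i)
    rw [← h] at h1
    have h2 : ∑ k, v k * rep cs w (rt i) k ≤ 0 :=
      Finset.sum_nonpos fun k _ => mul_nonpos_of_nonneg_of_nonpos (hv k).le (hh k)
    linarith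
  · have hh := (not_descent_iff cs w i).mp hd
    refine ⟨fun _ => hh, fun ha => ?_⟩
    have h1 : a * v i ≤ 0 := mul_nonpos_of_nonpos_of_nonneg ha (hv i).le
    rw [← h] at h1
    have h0 : ∀ k ∈ Finset.univ, 0 ≤ v k * rep cs w (rt i) k :=
      fun k _ => mul_nonneg (hv k).le (hh k)
    have h2 := (Finset.sum_eq_zero_iff_of_nonneg h0).mp (le_antisymm h1 (Finset.sum_nonneg h0))
    intro k
    have := h2 k (Finset.mem_univ _)
    rcases mul_eq_zero.mp this with h3 | h3
    · exact absurd h3 (hv k).ne'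
    · rw [h3]; simp

/-- state sequence -/
noncomputable def pr (μ : ℝ) : ℕ → ℝ × ℝ
  | 0 => (1, 1)
  | n + 1 => ((pr μ n).2 + μ * (pr μ n).1, -(pr μ n).1)

lemma altProd_succ' {W : Type*} [Monoid W] (x y : W) (n : ℕ) :
    altProd x y (n + 1) = altProd x y n * (if Even n then x else y) := by
  induction n generalizing x y with
  | zero => simp [altProd]
  | succ n ih =>
    rw [altProd, ih y x, ← mul_assoc, altProd]
    by_cases h : Even n <;> simp [h, Nat.even_add_one]

lemma altSum_succ' (a b n : ℕ) :
    altSum a b (n + 1) = altSum a b n + (if Even n then a else b) := by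
  induction n generalizing a b with
  | zero => simp [altSum]
  | succ n ih =>
    rw [altSum, ih b a, ← add_assoc, altSum]
    by_cases h : Even n <;> simp [h, Nat.even_add_one]

lemma altSum_ge (a b n : ℕ) (ha : 1 ≤ a) (hb : 1 ≤ b) : n ≤ altSum a b n := by
  induction n generalizing a b with
  | zero => simp
  | succ n ih => have := ih b a hb ha; rw [altSum]; omega

lemma pow_eq_altProd {W : Type*} [Group W] (x y : W) (hx : x⁻¹ = x) (hy : y⁻¹ = y) (n : ℕ) :
    (x * y) ^ n = altProd x y n * (altProd y x n)⁻¹ := by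
  induction n generalizing x y with
  | zero => simp [altProd]
  | succ n ih =>
    rw [altProd, altProd, mul_inv_rev, hy]
    have := ih y x hy hx
    have e : x * altProd y x n * ((altProd x y n)⁻¹ * y) = x * (y * x) ^ n * y := by
      rw [this]; group
    rw [e, mul_assoc, mul_pow_mul, pow_succ', mul_assoc]

/-- state of an alternating product. -/
lemma St.altProd {cs : CoxeterSystem M W} {v : B → ℝ} {α β : Set B} {μ : ℝ}
    (hα : Comm2 M α) (hβ : Comm2 M β) (hunion : α ∪ β = Set.univ) (hdisj : Disjoint α β)
    (hv : ∀ i, ∑ j, kk M i j * v j = (μ - 2) * v i)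
    (l l' : List B) (hn : l.Nodup) (hl : ∀ i, i ∈ l ↔ i ∈ α)
    (hn' : l'.Nodup) (hl' : ∀ i, i ∈ l' ↔ i ∈ β) (n : ℕ) :
    (Even n → St cs v α β (altProd (cs.wordProd l) (cs.wordProd l') n) (pr μ n).1 (pr μ n).2) ∧
    (¬ Even n → St cs v β α (altProd (cs.wordProd l) (cs.wordProd l') n) (pr μ n).1 (pr μ n).2) := by
  induction n with
  | zero => exact ⟨fun _ => St.one cs v α β, by simp⟩
  | succ n ih =>
    rw [altProd_succ', Nat.even_add_one, not_not]
    refine ⟨fun h => ?_, fun h => ?_⟩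
    · rw [if_neg h]
      exact St.step hβ hα (by rw [Set.union_comm, hunion]) hdisj.symm hv l' hn' hl' (ih.2 h)
    · rw [if_pos h]
      exact St.step hα hβ hunion hdisj hv l hn hl (ih.1 h)

lemma length_altProd {cs : CoxeterSystem M W} {v : B → ℝ} {α β : Set B} {μ : ℝ}
    (hα : Comm2 M α) (hβ : Comm2 M β) (hunion : α ∪ β = Set.univ) (hdisj : Disjoint α β)
    (hvp : ∀ i, 0 < v i)
    (hv : ∀ i, ∑ j, kk M i j * v j = (μ - 2) * v i)
    (l l' : List B) (hn : l.Nodup) (hl : ∀ i, i ∈ l ↔ i ∈ α)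
    (hn' : l'.Nodup) (hl' : ∀ i, i ∈ l' ↔ i ∈ β) (n : ℕ) (hpos : ∀ m < n, 0 < (pr μ m).1) :
    cs.length (altProd (cs.wordProd l) (cs.wordProd l') n) = altSum l.length l'.length n := by
  induction n with
  | zero => simp [_root_.altProd, altSum]
  | succ n ih =>
    have ih' := ih fun m hm => hpos m (by omega)
    have hs := St.altProd (cs := cs) hα hβ hunion hdisj hv l l' hn hl hn' hl' n
    have hp := hpos n (by omega)
    rw [altProd_succ', altSum_succ', ← ih']
    by_cases h : Even n
    · rw [if_pos h, if_pos h]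
      exact length_mul_list cs hα l _ hn (fun i hi => (hl i).mp hi)
        fun i hi => (sum_pos_of_nonneg cs v hvp _ i _ ((hs.1 h).1 i ((hl i).mp hi))).1 hp
    · rw [if_neg h, if_neg h]
      exact length_mul_list cs hβ l' _ hn' (fun i hi => (hl' i).mp hi)
        fun i hi => (sum_pos_of_nonneg cs v hvp _ i _ ((hs.2 h).1 i ((hl' i).mp hi))).1 hp

lemma altProd_longest {cs : CoxeterSystem M W} {v : B → ℝ} {α β : Set B} {μ : ℝ}
    (hα : Comm2 M α) (hβ : Comm2 M β) (hunion : α ∪ β = Set.univ) (hdisj : Disjoint α β)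
    (hvp : ∀ i, 0 < v i)
    (hv : ∀ i, ∑ j, kk M i j * v j = (μ - 2) * v i)
    (l l' : List B) (hn : l.Nodup) (hl : ∀ i, i ∈ l ↔ i ∈ α)
    (hn' : l'.Nodup) (hl' : ∀ i, i ∈ l' ↔ i ∈ β) (n : ℕ) (h1 : (pr μ n).1 ≤ 0)
    (h2 : (pr μ n).2 ≤ 0) (rI : W) (hr : IsLongestOf cs Set.univ rI) :
    altProd (cs.wordProd l) (cs.wordProd l') n = rI := by
  apply eq_longest cs rI hr
  intro i
  have hs := St.altProd (cs := cs) hα hβ hunion hdisj hv l l' hn hl hn' hl' n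
  have hi : i ∈ α ∪ β := by rw [hunion]; trivial
  by_cases h : Even n
  · rcases hi with hi | hi
    · exact (sum_pos_of_nonneg cs v hvp _ i _ ((hs.1 h).1 i hi)).2 h1
    · exact (sum_pos_of_nonneg cs v hvp _ i _ ((hs.1 h).2 i hi)).2 h2
  · rcases hi with hi | hi
    · exact (sum_pos_of_nonneg cs v hvp _ i _ ((hs.2 h).2 i hi)).2 h2
    · exact (sum_pos_of_nonneg cs v hvp _ i _ ((hs.2 h).1 i hi)).2 h1

lemma wordProd_inv (cs : CoxeterSystem M W) {α : Set B} (hα : Comm2 M α) (l : List B)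
    (hn : l.Nodup) (hl : ∀ i ∈ l, i ∈ α) : (cs.wordProd l)⁻¹ = cs.wordProd l := by
  rw [← cs.wordProd_reverse]
  rw [CoxeterSystem.wordProd, CoxeterSystem.wordProd]
  refine List.Perm.prod_eq' ((List.reverse_perm l).map _) ?_
  rw [List.pairwise_map]
  refine (List.nodup_reverse.mpr hn).imp_of_mem ?_
  intro a b ha hb hab
  exact simple_comm cs (hα a (hl a (by simpa using ha)) b (hl b (by simpa using hb)) hab)

end BipCox

open BipCox

/-- For the bipartite 2-partition `{α, β}` of an irreducible finite Coxeter system with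
Coxeter number `h` (the order of any Coxeter element), `∏_h(r_α, r_β) = r_I` and
`ℓ(r_I) = Σ_h(ℓ(r_α), ℓ(r_β))`. -/
theorem bipartite_partition_altProd_eq_longest {B W : Type*} [Group W] [Fintype B]
    {M : CoxeterMatrix B} (cs : CoxeterSystem M W) [Finite W]
    (hirr : ∀ J K : Set B, J ∪ K = Set.univ → Disjoint J K → J.Nonempty → K.Nonempty →
      ∃ j ∈ J, ∃ k ∈ K, M.M j k ≠ 2)
    (α β : Set B) (hunion : α ∪ β = Set.univ) (hdisj : Disjoint α β)
    (hα : α.Nonempty) (hβ : β.Nonempty)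
    (hbipα : ∀ i ∈ α, ∀ j ∈ α, i ≠ j → M.M i j = 2)
    (hbipβ : ∀ i ∈ β, ∀ j ∈ β, i ≠ j → M.M i j = 2)
    (h : ℕ)
    (hcox : ∀ l : List B, l.Nodup → (∀ i : B, i ∈ l) → orderOf (cs.wordProd l) = h)
    (rα rβ rI : W) (hrα : IsLongestOf cs α rα) (hrβ : IsLongestOf cs β rβ)
    (hrI : IsLongestOf cs Set.univ rI) :
    altProd rα rβ h = rI ∧ cs.length rI = altSum (cs.length rα) (cs.length rβ) h := by
  classical

  have : Nonempty B := ⟨hα.some⟩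
  obtain ⟨v, μ, hvp, hv⟩ := perron hirr
  obtain ⟨l, hn, hl⟩ : ∃ l : List B, l.Nodup ∧ ∀ i, i ∈ l ↔ i ∈ α :=
    ⟨α.toFinset.toList, Finset.nodup_toList _, by simp⟩
  obtain ⟨l', hn', hl'⟩ : ∃ l : List B, l.Nodup ∧ ∀ i, i ∈ l ↔ i ∈ β :=
    ⟨β.toFinset.toList, Finset.nodup_toList _, by simp⟩
  have hbα : Comm2 M α := hbipα
  have hbβ : Comm2 M β := hbipβ
  have ex := longest_eq cs hbα rα hrα l hn hl
  have ey := longest_eq cs hbβ rβ hrβ l' hn' hl'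
  have hunion' : β ∪ α = Set.univ := by rw [Set.union_comm, hunion]
  have hll : 1 ≤ l.length := List.length_pos_of_mem ((hl _).mpr hα.some_mem)
  have hll' : 1 ≤ l'.length := List.length_pos_of_mem ((hl' _).mpr hβ.some_mem)
  have lenP := fun n => length_altProd (cs := cs) hbα hbβ hunion hdisj hvp hv l l' hn hl hn' hl' n
  have hall : ∀ u : W, u ∈ Subgroup.closure (cs.simple '' Set.univ) := by
    intro u
    rw [Set.image_univ, cs.subgroup_closure_range_simple]; trivial
  have hex : ∃ n, (pr μ n).1 ≤ 0 := by
    by_contra hcon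
    push Not at hcon
    have h1 := lenP (cs.length rI + 1) (fun m _ => hcon m)
    have h2 := altSum_ge l.length l'.length (cs.length rI + 1) hll hll'
    have h3 := hrI.2.1 _ (hall (altProd (cs.wordProd l) (cs.wordProd l') (cs.length rI + 1)))
    omega
  obtain ⟨N, hN, hmin⟩ : ∃ N, (pr μ N).1 ≤ 0 ∧ ∀ m < N, 0 < (pr μ m).1 :=
    ⟨Nat.find hex, Nat.find_spec hex, fun m hm => not_le.mp (Nat.find_min hex hm)⟩
  have hN0 : 0 < N := by
    rcases Nat.eq_zero_or_pos N with h0 | h0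
    · rw [h0] at hN; simp [pr] at hN; linarith
    · exact h0
  have hR : ∀ n, 0 < n → n ≤ N → (pr μ n).2 < 0 := by
    intro n h0 hn
    obtain ⟨k, rfl⟩ : ∃ k, n = k + 1 := ⟨n - 1, by omega⟩
    have := hmin k (by omega)
    rw [pr]; simpa using this
  have hw1 := altProd_longest hbα hbβ hunion hdisj hvp hv l l' hn hl hn' hl' N hN
    (hR N hN0 le_rfl).le rI hrI
  have hw2 := altProd_longest hbβ hbα hunion' hdisj.symm hvp hv l' l hn' hl' hn hl N hN
    (hR N hN0 le_rfl).le rI hrI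
  have hxi := wordProd_inv cs hbα l hn fun i hi => (hl i).mp hi
  have hyi := wordProd_inv cs hbβ l' hn' fun i hi => (hl' i).mp hi
  have hord : orderOf (cs.wordProd l * cs.wordProd l') = N := by
    rw [orderOf_eq_iff hN0]
    refine ⟨by rw [pow_eq_altProd _ _ hxi hyi, hw1, hw2, mul_inv_cancel], ?_⟩
    intro m hm hm0 heq
    rw [pow_eq_altProd _ _ hxi hyi, mul_inv_eq_one] at heq
    have s1 := St.altProd (cs := cs) hbα hbβ hunion hdisj hv l l' hn hl hn' hl' m
    have s2 := St.altProd (cs := cs) hbβ hbα hunion' hdisj.symm hv l' l hn' hl' hn hl m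
    rw [← heq] at s2
    have p1 := hmin m hm
    have p2 := hR m hm0 hm.le
    by_cases he : Even m
    · have a1 := (s1.1 he).1 _ hα.some_mem
      have a2 := (s2.1 he).2 _ hα.some_mem
      rw [a1] at a2
      have := mul_right_cancel₀ (hvp _).ne' a2
      linarith
    · have a1 := (s1.2 he).1 _ hβ.some_mem
      have a2 := (s2.2 he).2 _ hβ.some_mem
      rw [a1] at a2
      have := mul_right_cancel₀ (hvp _).ne' a2
      linarith
  have hh : h = N := by
    rw [← hord, ← cs.wordProd_append]
    refine (hcox (l ++ l') ?_ ?_).symm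
    · refine List.Nodup.append hn hn' ?_
      intro a ha hb
      exact Set.disjoint_left.mp hdisj ((hl a).mp ha) ((hl' a).mp hb)
    · intro i
      have : i ∈ α ∪ β := by rw [hunion]; trivial
      rw [List.mem_append, hl, hl']
      exact this
  have lx : cs.length rα = l.length := by
    have := lenP 1 (fun m hm => hmin m (by omega))
    simpa [altProd, altSum, ← ex] using this
  have ly : cs.length rβ = l'.length := by
    have := length_altProd (cs := cs) hbβ hbα hunion' hdisj.symm hvp hv l' l hn' hl' hn hl 1
      (fun m hm => hmin m (by omega))
    simpa [altProd, altSum, ← ey] using this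
  rw [hh, lx, ly, ex, ey]
  exact ⟨hw1, by rw [← hw1]; exact lenP N hmin⟩
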